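/- arXiv:2604.15396 — 3 statements merged into one kernel-verified Lean document; each statement's English description precedes it below -/
import Mathlib

section
/- Let δ and γ be real numbers with 0 < δ < 1, and set s = δ + iγ. Then ζ(s) = 0 if and only if for all real x > 0, ∫₀^∞ t^{δ-1} · t^{iγ}/(e^{xt}+1) dt = 0, i.e. the bounded measurable function f(t) = t^{iγ} solves Salem's integral equation ∫₀^∞ t^{δ-1} f(t)/(e^{xt}+1) dt = 0 for all x > 0. -/
open MeasureTheory Complex Set

noncomputable def salemF (t : ℝ) : ℂ := 1 / ((Real.exp t : ℂ) + 1)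

lemma salemF_hasSum {t : ℝ} (ht : 0 < t) :
    HasSum (fun n : ℕ => (-1 : ℂ) ^ n * (Real.exp (-((n : ℝ) + 1) * t) : ℂ)) (salemF t) := by
  have hlt : ‖(-(Real.exp (-t) : ℂ))‖ < 1 := by
    rw [norm_neg, Complex.norm_real, Real.norm_eq_abs, abs_of_pos (Real.exp_pos _)]
    exact Real.exp_lt_one_iff.2 (by linarith)
  have h := (hasSum_geometric_of_norm_lt_one hlt).mul_left (Real.exp (-t) : ℂ)
  have e : (Real.exp (-t) : ℂ) * (1 - -(Real.exp (-t) : ℂ))⁻¹ = salemF t := by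
    have h1 : (Real.exp t : ℂ) ≠ 0 := by exact_mod_cast (Real.exp_pos t).ne'
    have h2 : (Real.exp t : ℂ) + 1 ≠ 0 := by
      exact_mod_cast (by positivity : Real.exp t + 1 ≠ 0)
    rw [salemF, Real.exp_neg, sub_neg_eq_add, ofReal_inv]
    have h3 : 1 + (Real.exp t : ℂ)⁻¹ ≠ 0 := by
      intro h
      apply h2
      have := congrArg (fun z => (Real.exp t : ℂ) * z) h
      simpa [mul_add, mul_inv_cancel₀ h1] using this
    field_simp
  rw [e] at h
  refine h.congr_fun fun n => ?_
  have : Real.exp (-((n : ℝ) + 1) * t) = Real.exp (-t) * Real.exp (-t) ^ n := by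
    rw [← Real.exp_nat_mul, ← Real.exp_add]
    congr 1; ring
  rw [this]
  push_cast
  rw [neg_pow ((cexp (-(t : ℂ)))) n]
  ring

lemma eta_hasSum {s : ℂ} (hs : 1 < s.re) :
    HasSum (fun n : ℕ => (-1 : ℂ) ^ n / ((n : ℂ) + 1) ^ s)
      ((1 - 2 ^ (1 - s)) * riemannZeta s) := by
  have hsum : Summable (fun n : ℕ => 1 / ((n : ℂ) + 1) ^ s) := by
    have := (summable_nat_add_iff 1).2 (Complex.summable_one_div_nat_cpow.2 hs)
    simpa using this
  have hz : HasSum (fun n : ℕ => 1 / ((n : ℂ) + 1) ^ s) (riemannZeta s) := by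
    rw [zeta_eq_tsum_one_div_nat_add_one_cpow hs]; exact hsum.hasSum
  have hodd : HasSum (fun k : ℕ => 1 / (((2 * k + 1 : ℕ) : ℂ) + 1) ^ s)
      (2 ^ (-s) * riemannZeta s) := by
    refine (hz.mul_left (2 ^ (-s))).congr_fun fun k => ?_
    have e : (((2 * k + 1 : ℕ) : ℂ) + 1) = ((2 : ℝ) : ℂ) * ((k + 1 : ℝ) : ℂ) := by
      push_cast; ring
    rw [e, mul_cpow_ofReal_nonneg (by norm_num) (by positivity), cpow_neg]
    push_cast
    field_simp
  have hev : Summable (fun k : ℕ => 1 / (((2 * k : ℕ) : ℂ) + 1) ^ s) :=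
    hsum.comp_injective (i := fun k : ℕ => 2 * k) (fun a b h => by simpa using h)
  have htot := HasSum.even_add_odd (f := fun n : ℕ => 1 / ((n : ℂ) + 1) ^ s) hev.hasSum hodd
  have hA := htot.unique hz
  have h2 : (2 : ℂ) ^ (1 - s) = 2 * 2 ^ (-s) := by
    rw [sub_eq_add_neg, cpow_add _ _ two_ne_zero, cpow_one]
  have key := HasSum.even_add_odd (f := fun n : ℕ => (-1 : ℂ) ^ n / ((n : ℂ) + 1) ^ s)
    (m := ∑' k : ℕ, 1 / (((2 * k : ℕ) : ℂ) + 1) ^ s) (m' := -(2 ^ (-s) * riemannZeta s))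
    (hev.hasSum.congr_fun fun k => by simp [pow_mul])
    (hodd.neg.congr_fun fun k => by simp [pow_mul, pow_succ, neg_div])
  convert key using 1
  rw [h2]
  linear_combination -hA

lemma mellin_salemF {s : ℂ} (hs : 1 < s.re) :
    mellin salemF s = Gamma s * ((1 - 2 ^ (1 - s)) * riemannZeta s) := by
  have hn := (summable_nat_add_iff 1).2 (Real.summable_one_div_nat_rpow.2 hs)
  have h := hasSum_mellin (a := fun n : ℕ => (-1 : ℂ) ^ n) (p := fun n : ℕ => (n : ℝ) + 1)
    (F := salemF) (s := s) (fun i => Or.inr (by positivity)) (by linarith)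
    (fun t ht => salemF_hasSum ht) (by simpa using hn)
  refine h.unique (((eta_hasSum hs).mul_left (Gamma s)).congr_fun fun n => ?_)
  push_cast
  ring

lemma salemF_cont : Continuous salemF := by
  unfold salemF
  refine continuous_const.div (by fun_prop) fun t => ?_
  exact_mod_cast (by positivity : Real.exp t + 1 ≠ 0)

lemma salemF_norm (t : ℝ) : ‖salemF t‖ = 1 / (Real.exp t + 1) := by
  have : salemF t = ((1 / (Real.exp t + 1) : ℝ) : ℂ) := by simp [salemF]
  rw [this, Complex.norm_real, Real.norm_eq_abs, abs_of_pos (by positivity)]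

lemma mellin_salemF_diff {s : ℂ} (hs : 0 < s.re) : DifferentiableAt ℂ (mellin salemF) s := by
  refine mellin_differentiableAt_of_isBigO_rpow_exp (a := 1) (b := 0) one_pos
    (salemF_cont.locallyIntegrable.locallyIntegrableOn _) ?_ ?_ hs
  · refine Asymptotics.IsBigO.of_bound 1 (Filter.Eventually.of_forall fun t => ?_)
    rw [salemF_norm, one_mul, Real.norm_eq_abs, abs_of_pos (Real.exp_pos _), neg_one_mul,
      Real.exp_neg, one_div]
    exact inv_anti₀ (Real.exp_pos _) (by linarith)
  · refine Asymptotics.IsBigO.of_bound 1 (Filter.Eventually.of_forall fun t => ?_)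
    rw [salemF_norm]
    simp only [neg_zero, Real.rpow_zero, norm_one, mul_one]
    rw [div_le_one (by positivity)]
    linarith [Real.exp_pos t]

noncomputable def zetaG : ℂ → ℂ := Function.update (fun s => (s - 1) * riemannZeta s) 1 1

lemma zetaG_of_ne {s : ℂ} (h : s ≠ 1) : zetaG s = (s - 1) * riemannZeta s := by
  simp [zetaG, h]

lemma zetaG_diff : Differentiable ℂ zetaG := by
  have off : ∀ s : ℂ, s ≠ 1 → DifferentiableAt ℂ zetaG s := fun s h => by
    have : DifferentiableAt ℂ (fun s => (s - 1) * riemannZeta s) s :=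
      (by fun_prop : DifferentiableAt ℂ (fun s : ℂ => s - 1) s).mul
        (differentiableAt_riemannZeta h)
    refine this.congr_of_eventuallyEq ?_
    filter_upwards [isOpen_ne.mem_nhds h] with z hz
    exact zetaG_of_ne hz
  intro s
  by_cases h : s = 1
  · subst h
    refine (Complex.analyticAt_of_differentiable_on_punctured_nhds_of_continuousAt ?_
      ?_).differentiableAt
    · filter_upwards [self_mem_nhdsWithin] with z hz
      exact off z hz
    · exact continuousAt_update_same.2 riemannZeta_residue_one
  · exact off s h

lemma mellin_salemF_ext {s : ℂ} (hs : 0 < s.re) (h1 : s ≠ 1) :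
    mellin salemF s = Gamma s * ((1 - 2 ^ (1 - s)) * riemannZeta s) := by
  have ho : IsOpen {z : ℂ | 0 < z.re} := isOpen_lt continuous_const continuous_re
  have hf : AnalyticOnNhd ℂ (fun s => (s - 1) * mellin salemF s) {z : ℂ | 0 < z.re} :=
    DifferentiableOn.analyticOnNhd (fun z hz => (DifferentiableAt.mul (by fun_prop)
      (mellin_salemF_diff hz)).differentiableWithinAt) ho
  have hg : AnalyticOnNhd ℂ (fun s => Gamma s * ((1 - 2 ^ (1 - s)) * zetaG s))
      {z : ℂ | 0 < z.re} := by
    refine DifferentiableOn.analyticOnNhd (fun z hz => (DifferentiableAt.mul ?_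
      (DifferentiableAt.mul ?_ (zetaG_diff z))).differentiableWithinAt) ho
    · refine differentiableAt_Gamma _ fun m hm => ?_
      have : 0 < z.re := hz
      rw [hm] at this
      simp at this
      linarith [(Nat.cast_nonneg m : (0 : ℝ) ≤ m)]
    · refine (differentiableAt_const _).sub (DifferentiableAt.const_cpow (by fun_prop) ?_)
      exact Or.inl two_ne_zero
  have hc : IsPreconnected {z : ℂ | 0 < z.re} := (convex_halfSpace_re_gt 0).isPreconnected
  have key := hf.eqOn_of_preconnected_of_eventuallyEq hg hc (z₀ := 2) (by simp) ?_
  · have := key hs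
    simp only [zetaG_of_ne h1] at this
    apply mul_left_cancel₀ (sub_ne_zero.2 h1)
    rw [this]; ring
  · have : {z : ℂ | 1 < z.re} ∈ nhds (2 : ℂ) :=
      (isOpen_lt continuous_const continuous_re).mem_nhds (by simp)
    filter_upwards [this] with z hz
    have hz1 : z ≠ 1 := by
      rintro rfl
      simp at hz
    rw [mellin_salemF hz, zetaG_of_ne hz1]; ring

lemma salem_integral_eq (δ γ x : ℝ) (hx : 0 < x) :
    ∫ t in Ioi (0 : ℝ),
      (t : ℂ) ^ ((δ : ℂ) - 1) * (t : ℂ) ^ (γ * I) / (Real.exp (x * t) + 1)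
      = (x : ℂ) ^ (-(δ + γ * I : ℂ)) * mellin salemF (δ + γ * I) := by
  have hc := mellin_comp_mul_left salemF (δ + γ * I : ℂ) hx
  rw [smul_eq_mul] at hc
  rw [← hc, mellin]
  refine setIntegral_congr_fun measurableSet_Ioi fun t ht => ?_
  have ht0 : (t : ℂ) ≠ 0 := ofReal_ne_zero.2 (ne_of_gt ht)
  simp only [salemF, smul_eq_mul]
  rw [← cpow_add _ _ ht0, mul_one_div]
  congr 2
  ring

theorem zeta_zero_iff_salem_solution (δ γ : ℝ) (h0 : 0 < δ) (h1 : δ < 1) :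
    riemannZeta (δ + γ * I) = 0 ↔
      ∀ x : ℝ, 0 < x →
        ∫ t in Ioi (0 : ℝ),
          (t : ℂ) ^ ((δ : ℂ) - 1) * (t : ℂ) ^ (γ * I) / (Real.exp (x * t) + 1) = 0 := by
  have hre : (δ + γ * I : ℂ).re = δ := by simp
  have hne : (δ + γ * I : ℂ) ≠ 1 := by
    intro h
    have := congrArg re h
    rw [hre, one_re] at this
    linarith
  have hm := mellin_salemF_ext (s := δ + γ * I) (by rw [hre]; exact h0) hne
  constructor
  · intro h x hx
    rw [salem_integral_eq δ γ x hx, hm, h]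
    simp
  · intro h
    have h' := h 1 one_pos
    rw [salem_integral_eq δ γ 1 one_pos, hm, ofReal_one, one_cpow, one_mul] at h'
    have hG : Gamma (δ + γ * I) ≠ 0 := Gamma_ne_zero_of_re_pos (by rw [hre]; exact h0)
    have h2 : (1 - 2 ^ (1 - (δ + γ * I : ℂ)) : ℂ) ≠ 0 := by
      intro h
      have e : (2 : ℂ) ^ (1 - (δ + γ * I : ℂ)) = 1 := (sub_eq_zero.1 h).symm
      have n := congrArg norm e
      have : ‖((2 : ℝ) : ℂ) ^ (1 - (δ + γ * I : ℂ))‖ = 2 ^ (1 - (δ + γ * I : ℂ)).re :=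
        norm_cpow_eq_rpow_re_of_pos two_pos _
      rw [ofReal_ofNat, n, sub_re, hre, one_re, norm_one] at this
      linarith [Real.one_lt_rpow (one_lt_two : (1 : ℝ) < 2) (by linarith : 0 < 1 - δ)]
    rcases mul_eq_zero.1 h' with h' | h'
    · exact absurd h' hG
    · exact (mul_eq_zero.1 h').resolve_left h2
end

section
/- The Riemann Hypothesis holds if and only if for every real δ with 1/2 < δ < 1 and every real γ, it is NOT the case that ∫₀^∞ t^{δ-1} · t^{iγ}/(e^{xt}+1) dt = 0 for all real x > 0; equivalently, for each δ ∈ (1/2, 1), Salem's integral equation ∫₀^∞ t^{δ-1} f(t)/(e^{xt}+1) dt = 0 (for all x > 0) has no solution of the form f(t) = t^{iγ} with γ ∈ ℝ. -/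
open MeasureTheory Complex Set

noncomputable def salemG (t : ℝ) : ℂ := 1 / (Real.exp t + 1)

lemma salemG_den (t : ℝ) : ((Real.exp t : ℂ) + 1) ≠ 0 := by
  have : (0:ℝ) < Real.exp t + 1 := by positivity
  exact_mod_cast this.ne'

lemma salemG_cont : Continuous salemG := by
  unfold salemG
  refine Continuous.div continuous_const (by fun_prop) salemG_den

lemma salemG_norm (t : ℝ) : ‖salemG t‖ ≤ Real.exp (-t) := by
  have : salemG t = ((1 / (Real.exp t + 1) : ℝ) : ℂ) := by simp [salemG]
  rw [this, Complex.norm_real, Real.norm_of_nonneg (by positivity), Real.exp_neg, ← one_div]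
  gcongr
  linarith

lemma salemG_diff {s : ℂ} (hs : 0 < s.re) : DifferentiableAt ℂ (mellin salemG) s := by
  refine mellin_differentiableAt_of_isBigO_rpow_exp (a := 1) (b := 0) one_pos
    (salemG_cont.continuousOn.locallyIntegrableOn measurableSet_Ioi) ?_ ?_ hs
  · refine Asymptotics.IsBigO.of_bound 1 (.of_forall fun t => ?_)
    simpa using salemG_norm t
  · refine Asymptotics.IsBigO.of_bound 1 ?_
    filter_upwards [self_mem_nhdsWithin] with t ht
    have ht : 0 < t := ht
    refine (salemG_norm t).trans ?_
    simp [ht.le]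

lemma salem_hasSum_exp {t : ℝ} (ht : 0 < t) :
    HasSum (fun n : ℕ => ((Real.exp (-(n + 1 : ℝ) * t) : ℝ) : ℂ)) (1 / ((Real.exp t : ℂ) - 1)) := by
  have h1 : Real.exp (-t) < 1 := by simpa using ht
  have h := (hasSum_geometric_of_lt_one (Real.exp_pos (-t)).le h1).mul_left (Real.exp (-t))
  have h2 : Real.exp (-t) * (1 - Real.exp (-t))⁻¹ = 1 / (Real.exp t - 1) := by
    have : 1 < Real.exp t := by simpa using ht
    rw [Real.exp_neg]
    have h3 : Real.exp t - 1 ≠ 0 := by linarith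
    field_simp
  rw [h2] at h
  have h' := Complex.hasSum_ofReal.mpr h
  convert h' using 1
  · funext n
    rw [← Real.exp_nat_mul, ← Real.exp_add]
    congr 2
    ring
  · push_cast; rfl

lemma salem_mellin_of_one_lt {s : ℂ} (hs : 1 < s.re) :
    mellin salemG s = Gamma s * ((1 - 2 ^ (1 - s)) * riemannZeta s) := by
  have hsum : Summable fun n : ℕ => 1 / ((n : ℝ) + 1) ^ s.re := by
    have := (summable_nat_add_iff 1).mpr (Real.summable_one_div_nat_rpow.mpr hs)
    simpa using this
  have hz : HasSum (fun n : ℕ => 1 / ((n : ℂ) + 1) ^ s) (riemannZeta s) := by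
    rw [zeta_eq_tsum_one_div_nat_add_one_cpow hs]
    refine Summable.hasSum ?_
    have := (summable_nat_add_iff 1).mpr (Complex.summable_one_div_nat_cpow.mpr hs)
    simpa using this
  have key := hasSum_mellin (ι := ℕ ⊕ ℕ) (a := Sum.elim (fun _ => 1) (fun _ => -2))
    (p := Sum.elim (fun n => (n : ℝ) + 1) (fun n => 2 * ((n : ℝ) + 1))) (F := salemG) (s := s)
    (by rintro (n | n) <;> right <;> simp <;> positivity) (by linarith) ?_ ?_
  · refine key.unique ?_
    have : Gamma s * ((1 - 2 ^ (1 - s)) * riemannZeta s) =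
      Gamma s * riemannZeta s + (-Gamma s * 2 ^ (1 - s)) * riemannZeta s := by ring
    rw [this]
    refine HasSum.sum ?_ ?_
    · convert! hz.mul_left (Gamma s) using 1
      funext n
      simp [div_eq_mul_inv]
    · convert! hz.mul_left (-Gamma s * 2 ^ (1 - s)) using 1
      funext n
      have h2 : ((2 : ℂ) * ((n : ℂ) + 1)) ^ s = 2 ^ s * ((n : ℂ) + 1) ^ s := by
        have := Complex.mul_cpow_ofReal_nonneg (a := 2) (b := (n : ℝ) + 1) (by norm_num)
          (by positivity) s
        simpa using this
      simp only [Function.comp, Sum.elim_inr]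
      push_cast
      rw [h2, Complex.cpow_sub _ _ two_ne_zero, Complex.cpow_one]
      simp only [div_eq_mul_inv, mul_inv]
      ring
  · intro t ht
    have ht : 0 < t := ht
    have h1 := salem_hasSum_exp ht
    have h2 := (salem_hasSum_exp (t := 2 * t) (by positivity)).mul_left (-2)
    have e : salemG t = 1 / ((Real.exp t : ℂ) - 1) + (-2) * (1 / ((Real.exp (2 * t) : ℂ) - 1)) := by
      have h3 : 1 < Real.exp t := by simpa using ht
      have h4 : (Real.exp t : ℂ) - 1 ≠ 0 := by
        have : Real.exp t - 1 ≠ 0 := by linarith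
        exact_mod_cast this
      have h5 := salemG_den t
      have h6 : ((Real.exp (2 * t) : ℝ) : ℂ) - 1 = (Real.exp t - 1) * (Real.exp t + 1) := by
        rw [two_mul, Real.exp_add]; push_cast; ring
      rw [h6, salemG]
      field_simp
      ring
    rw [e]
    refine HasSum.sum ?_ ?_
    · convert! h1 using 1
      funext n
      simp only [Function.comp, Sum.elim_inl, one_mul]
    · convert! h2 using 1
      funext n
      simp only [Function.comp, Sum.elim_inr]
      congr 3
      ring
  · refine Summable.sum _ ?_ ?_
    · convert! hsum using 1
      funext n; simp
    · convert! hsum.mul_left (2 / 2 ^ s.re) using 1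
      funext n
      simp only [Function.comp, Sum.elim_inr]
      rw [Real.mul_rpow (by norm_num) (by positivity)]
      simp only [div_eq_mul_inv, mul_inv]
      simp
      ring

lemma salem_preconn : IsPreconnected ({s : ℂ | 0 < s.re} \ {1}) := by
  have hA : IsPreconnected {s : ℂ | 1 < s.re} := (convex_halfSpace_re_gt 1).isPreconnected
  have hB : IsPreconnected ({s : ℂ | 0 < s.re} ∩ {s : ℂ | 0 < s.im}) :=
    ((convex_halfSpace_re_gt 0).inter (convex_halfSpace_im_gt 0)).isPreconnected
  have hC : IsPreconnected ({s : ℂ | 0 < s.re} ∩ {s : ℂ | s.im < 0}) :=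
    ((convex_halfSpace_re_gt 0).inter (convex_halfSpace_im_lt 0)).isPreconnected
  have hE : IsPreconnected ({s : ℂ | 0 < s.re} ∩ {s : ℂ | s.re < 1}) :=
    ((convex_halfSpace_re_gt 0).inter (convex_halfSpace_re_lt 1)).isPreconnected
  have h := ((hA.union (2 + I) (by simp) (by simp) hB).union (2 - I) (by simp) (by simp) hC).union
    (1 / 2 + I) (by simp) (by simp; norm_num) hE
  convert h using 1
  ext s
  simp only [mem_sdiff, mem_ofPred_eq, mem_singleton_iff, mem_union, mem_inter_iff, Complex.ext_iff,
    one_re, one_im]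
  constructor
  · rintro ⟨h0, h1⟩
    rcases lt_trichotomy s.re 1 with h | h | h
    · tauto
    · rcases lt_trichotomy s.im 0 with h' | h' | h'
      · tauto
      · tauto
      · tauto
    · tauto
  · rintro (((h | h) | h) | h)
    · exact ⟨by linarith, fun h' => by linarith [h'.1]⟩
    · exact ⟨by linarith [h.1], fun h' => by linarith [h'.2, h.2]⟩
    · exact ⟨by linarith [h.1], fun h' => by linarith [h'.2, h.2]⟩
    · exact ⟨by linarith [h.1], fun h' => by linarith [h'.1, h.2]⟩

lemma salem_mellin {s : ℂ} (hs : 0 < s.re) (h1 : s ≠ 1) :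
    mellin salemG s = Gamma s * ((1 - 2 ^ (1 - s)) * riemannZeta s) := by
  have ho : IsOpen ({s : ℂ | 0 < s.re} \ {1}) :=
    (isOpen_lt continuous_const continuous_re).sdiff isClosed_singleton
  refine AnalyticOnNhd.eqOn_of_preconnected_of_eventuallyEq (𝕜 := ℂ) (z₀ := 2)
    (f := mellin salemG) (g := fun s => Gamma s * ((1 - 2 ^ (1 - s)) * riemannZeta s))
    (DifferentiableOn.analyticOnNhd (fun z hz => (salemG_diff hz.1).differentiableWithinAt) ho)
    (DifferentiableOn.analyticOnNhd (fun z hz => ?_) ho) salem_preconn (by simp) ?_ ⟨hs, h1⟩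
  · refine DifferentiableAt.differentiableWithinAt ?_
    have hz0 : 0 < z.re := hz.1
    refine (Complex.differentiableAt_Gamma z fun m hm => ?_).mul (DifferentiableAt.mul ?_
      (differentiableAt_riemannZeta hz.2))
    · rw [hm] at hz0
      simp at hz0
      have : (0:ℝ) ≤ m := by positivity
      linarith
    · refine (differentiableAt_const _).sub (DifferentiableAt.const_cpow (by fun_prop) (Or.inl two_ne_zero))
  · filter_upwards [(isOpen_lt continuous_const continuous_re).mem_nhds
      (show (2:ℂ) ∈ {s : ℂ | 1 < s.re} by simp)] with z hz
    exact salem_mellin_of_one_lt hz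

lemma salem_zero_iff {s : ℂ} (hs : 0 < s.re) (h1 : s.re < 1) :
    mellin salemG s = 0 ↔ riemannZeta s = 0 := by
  rw [salem_mellin hs (by rintro rfl; simp at h1)]
  have h2 : (1 : ℂ) - 2 ^ (1 - s) ≠ 0 := by
    intro h
    have h3 : ‖(2 : ℂ) ^ (1 - s)‖ = 1 := by rw [← sub_eq_zero.mp h]; simp
    have h4 := Complex.norm_cpow_eq_rpow_re_of_pos (x := 2) (by norm_num) (1 - s)
    rw [Complex.ofReal_ofNat, h3] at h4
    have : (1:ℝ) < 2 ^ (1 - s).re := Real.one_lt_rpow (by norm_num) (by simp; linarith)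
    linarith
  simp [Gamma_ne_zero_of_re_pos hs, h2]

lemma salem_integral (δ γ x : ℝ) (hx : 0 < x) :
    ∫ t in Ioi (0 : ℝ),
      (t : ℂ) ^ ((δ : ℂ) - 1) * (t : ℂ) ^ (γ * I) / (Real.exp (x * t) + 1) =
      (x : ℂ) ^ (-((δ : ℂ) + γ * I)) * mellin salemG (δ + γ * I) := by
  have := mellin_comp_mul_left salemG (δ + γ * I) hx
  rw [smul_eq_mul] at this
  rw [← this, mellin]
  refine setIntegral_congr_fun measurableSet_Ioi fun t ht => ?_
  have ht : 0 < t := ht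
  have ht' : (t : ℂ) ≠ 0 := by exact_mod_cast ht.ne'
  simp only [smul_eq_mul, salemG]
  rw [← Complex.cpow_add _ _ ht', mul_one_div]
  congr 2
  ring

lemma salem_strip {s : ℂ} (hz : riemannZeta s = 0) (ht : ¬∃ n : ℕ, s = -2 * (n + 1)) :
    0 < s.re ∧ riemannZeta (1 - s) = 0 := by
  have h1 : s.re < 1 := by
    by_contra h
    exact riemannZeta_ne_zero_of_one_le_re (not_lt.mp h) hz
  have h0 : s ≠ 0 := by
    rintro rfl
    rw [riemannZeta_zero] at hz
    norm_num at hz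
  have hw : 0 < (1 - s).re := by simp; linarith
  have fe := riemannZeta_one_sub (s := 1 - s) (fun n hn => by
    rw [hn] at hw
    simp at hw
    have : (0:ℝ) ≤ n := by positivity
    linarith) (by simpa using h0)
  rw [sub_sub_cancel, hz] at fe
  have hG := Gamma_ne_zero_of_re_pos hw
  have hp : (2 * (Real.pi : ℂ)) ^ (-(1 - s)) ≠ 0 := by
    rw [Ne, Complex.cpow_eq_zero_iff]
    simp [Real.pi_ne_zero]
  have hc : cos (Real.pi * (1 - s) / 2) ≠ 0 := by
    intro hc
    rw [Complex.cos_eq_zero_iff] at hc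
    obtain ⟨k, hk⟩ := hc
    have hpi : (Real.pi : ℂ) ≠ 0 := by simp [Real.pi_ne_zero]
    have hs : s = -2 * k := by
      have : (Real.pi : ℂ) * (1 - s) = Real.pi * (2 * k + 1) := by linear_combination 2 * hk
      have := mul_left_cancel₀ hpi this
      linear_combination -this
    have hk0 : k ≠ 0 := by rintro rfl; simp at hs; exact h0 hs
    have hkn : 0 ≤ k := by
      rw [hs] at h1
      have h1' : -2 * (k:ℝ) < 1 := by simpa using h1
      have : (-1 : ℝ) < k := by linarith
      have : (-1 : ℤ) < k := by exact_mod_cast this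
      omega
    obtain ⟨n, hn⟩ := Int.eq_ofNat_of_zero_le (show 0 ≤ k - 1 by omega)
    obtain rfl : k = n + 1 := by omega
    exact ht ⟨n, by rw [hs]; push_cast; ring⟩
  have hz' : riemannZeta (1 - s) = 0 := by
    simpa [hG, hp, hc] using fe.symm
  refine ⟨?_, hz'⟩
  by_contra h
  exact riemannZeta_ne_zero_of_one_le_re (s := 1 - s) (by simp; linarith) hz'

theorem riemannHypothesis_iff_salem_no_power_solutions :
    RiemannHypothesis ↔
      ∀ δ : ℝ, 1 / 2 < δ → δ < 1 → ∀ γ : ℝ,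
        ¬ (∀ x : ℝ, 0 < x →
            ∫ t in Ioi (0 : ℝ),
              (t : ℂ) ^ ((δ : ℂ) - 1) * (t : ℂ) ^ (γ * I) / (Real.exp (x * t) + 1) = 0) := by
  constructor
  · intro RH δ h1 h2 γ h
    have h := h 1 one_pos
    rw [salem_integral δ γ 1 one_pos] at h
    simp only [ofReal_one, one_cpow, one_mul] at h
    have hre : ((δ : ℂ) + γ * I).re = δ := by simp
    rw [salem_zero_iff (by rw [hre]; linarith) (by rw [hre]; exact h2)] at h
    have := RH _ h (by
      rintro ⟨n, hn⟩
      have := congrArg re hn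
      rw [hre] at this
      simp at this
      have : (0:ℝ) ≤ n := by positivity
      linarith) (by
      intro hn
      have := congrArg re hn
      rw [hre] at this
      simp at this
      linarith)
    rw [hre] at this
    linarith
  · intro H
    have key : ∀ s : ℂ, riemannZeta s = 0 → s.re ≤ 1 / 2 := by
      intro s hz
      by_contra! h
      have h1 : s.re < 1 := by
        by_contra h
        exact riemannZeta_ne_zero_of_one_le_re (not_lt.mp h) hz
      refine H s.re h h1 s.im fun x hx => ?_
      rw [salem_integral _ _ _ hx, Complex.re_add_im, (salem_zero_iff (by linarith) h1).mpr hz,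
        mul_zero]
    intro s hz ht _
    have h1 := key s hz
    have h2 := key _ (salem_strip hz ht).2
    simp at h2
    linarith
end

section
/- The Riemann Hypothesis holds if and only if for every real δ with 0 < δ < 1 and δ ≠ 1/2, and every real γ, it is NOT the case that ∫₀^∞ t^{δ-1} · t^{iγ}/(e^{xt}+1) dt = 0 for all real x > 0; equivalently, for each such δ, Salem's integral equation ∫₀^∞ t^{δ-1} f(t)/(e^{xt}+1) dt = 0 (for all x > 0) has no solution of the form f(t) = t^{iγ} with γ ∈ ℝ. -/
open MeasureTheory Complex Set

open Filter Topology in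
lemma salem_aux_bose {s : ℂ} (hs : 1 < s.re) :
    mellin (fun t : ℝ => ((1 / (Real.exp t - 1) : ℝ) : ℂ)) s = Gamma s * riemannZeta s := by
  have h := hasSum_mellin (a := fun _ : ℕ => (1 : ℂ)) (p := fun n : ℕ => (n : ℝ) + 1)
    (F := fun t : ℝ => ((1 / (Real.exp t - 1) : ℝ) : ℂ)) (s := s)
    (fun i => Or.inr (by positivity)) (by linarith) ?_ ?_
  · rw [← h.tsum_eq, zeta_eq_tsum_one_div_nat_add_one_cpow hs, ← tsum_mul_left]
    refine tsum_congr fun n => ?_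
    push_cast
    ring
  · intro t ht
    have ht : 0 < t := ht
    have h1 : Real.exp (-t) < 1 := by simpa using ht
    have h2 := (hasSum_geometric_of_lt_one (Real.exp_pos (-t)).le h1).mul_left (Real.exp (-t))
    have h3 : Real.exp (-t) * (1 - Real.exp (-t))⁻¹ = 1 / (Real.exp t - 1) := by
      have : 1 < Real.exp t := by simpa using ht
      rw [Real.exp_neg]
      have h4 : Real.exp t - 1 ≠ 0 := by linarith
      have h5 : 1 - (Real.exp t)⁻¹ ≠ 0 := by
        rw [Real.exp_neg] at h1; linarith
      field_simp
    rw [h3] at h2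
    have h4 := Complex.hasSum_ofReal.mpr h2
    refine h4.congr_fun ?_ |> fun h => h
    intro n
    rw [one_mul]
    congr 1
    rw [← Real.exp_nat_mul, ← Real.exp_add]
    congr 1
    ring
  · have := (summable_nat_add_iff 1).mpr (Real.summable_one_div_nat_rpow.mpr hs)
    simpa using this

lemma salem_aux_fermi {s : ℂ} (hs : 1 < s.re) :
    mellin (fun t : ℝ => ((1 / (Real.exp t + 1) : ℝ) : ℂ)) s =
      Gamma s * (1 - 2 ^ (1 - s)) * riemannZeta s := by
  set b : ℝ → ℂ := fun t : ℝ => ((1 / (Real.exp t - 1) : ℝ) : ℂ) with hb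
  have hB := salem_aux_bose hs
  have hne : Gamma s * riemannZeta s ≠ 0 :=
    mul_ne_zero (Gamma_ne_zero_of_re_pos (by linarith)) (riemannZeta_ne_zero_of_one_lt_re hs)
  have hc : MellinConvergent b s := by
    by_contra hcon
    apply hne
    rw [← hB]
    exact integral_undef hcon
  have hc2 : MellinConvergent (fun t => b (2 * t)) s :=
    (MellinConvergent.comp_mul_left (by norm_num)).mpr hc
  have h1 := hasMellin_sub hc (hc2.const_smul (2 : ℂ))
  have h2 : mellin (fun t : ℝ => ((1 / (Real.exp t + 1) : ℝ) : ℂ)) s =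
      mellin (fun t => b t - (2 : ℂ) • b (2 * t)) s := by
    refine setIntegral_congr_fun measurableSet_Ioi fun t ht => ?_
    have ht : 0 < t := ht
    have h3 : 1 < Real.exp t := by simpa using ht
    simp only [hb]
    congr 1
    rw [smul_eq_mul, ← ofReal_ofNat, ← ofReal_mul, ← ofReal_sub]
    congr 1
    have : Real.exp (2 * t) = Real.exp t ^ 2 := by rw [← Real.exp_nat_mul]; norm_num
    rw [this]
    have e1 : Real.exp t - 1 ≠ 0 := by linarith
    have e2 : Real.exp t + 1 ≠ 0 := by linarith
    have e3 : Real.exp t ^ 2 - 1 ≠ 0 := by nlinarith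
    field_simp
    ring
  rw [h2, h1.2, mellin_const_smul, mellin_comp_mul_left _ _ (by norm_num : (0:ℝ) < 2), hB]
  rw [sub_eq_add_neg 1 s, cpow_add _ _ two_ne_zero, cpow_one]
  simp only [smul_eq_mul, ofReal_ofNat]
  ring

open Filter Topology Asymptotics in
lemma salem_aux_diff {s : ℂ} (hs : 0 < s.re) :
    DifferentiableAt ℂ (mellin (fun t : ℝ => ((1 / (Real.exp t + 1) : ℝ) : ℂ))) s := by
  have hcont : Continuous (fun t : ℝ => ((1 / (Real.exp t + 1) : ℝ) : ℂ)) := by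
    refine continuous_ofReal.comp (continuous_const.div (by fun_prop) fun t => ?_)
    positivity
  refine mellin_differentiableAt_of_isBigO_rpow_exp (a := 1) (b := 0) one_pos
    (hcont.locallyIntegrable.locallyIntegrableOn _) ?_ ?_ hs
  · refine IsBigO.of_bound 1 (Eventually.of_forall fun t => ?_)
    rw [norm_real, Real.norm_of_nonneg (by positivity), Real.norm_of_nonneg (by positivity),
      one_mul, neg_mul, one_mul, Real.exp_neg, one_div]
    gcongr
    linarith
  · refine IsBigO.of_bound 1 (Eventually.of_forall fun t => ?_)
    rw [norm_real, Real.norm_of_nonneg (by positivity)]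
    simp only [neg_zero, Real.rpow_zero, norm_one, mul_one]
    rw [div_le_one (by positivity)]
    linarith [Real.exp_pos t]

open Filter Topology in
lemma salem_aux_main {s : ℂ} (hs : 0 < s.re) (hs1 : s ≠ 1) :
    mellin (fun t : ℝ => ((1 / (Real.exp t + 1) : ℝ) : ℂ)) s =
      Gamma s * (1 - 2 ^ (1 - s)) * riemannZeta s := by
  set M := mellin (fun t : ℝ => ((1 / (Real.exp t + 1) : ℝ) : ℂ)) with hM
  set g : ℂ → ℂ := Function.update (fun s => (s - 1) * riemannZeta s) 1 1 with hg
  have hgne : ∀ z : ℂ, z ≠ 1 → g z = (z - 1) * riemannZeta z := fun z hz => by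
    simp [hg, hz]
  have hgd' : ∀ z : ℂ, z ≠ 1 → DifferentiableAt ℂ g z := fun z hz => by
    have : g =ᶠ[𝓝 z] fun s => (s - 1) * riemannZeta s := by
      filter_upwards [isOpen_ne.mem_nhds hz] with w hw using hgne w hw
    refine DifferentiableAt.congr_of_eventuallyEq ?_ this
    exact (differentiableAt_id.sub_const 1).mul (differentiableAt_riemannZeta hz)
  have hgd : Differentiable ℂ g := fun z => by
    by_cases hz : z = 1
    · subst hz
      refine (Complex.analyticAt_of_differentiable_on_punctured_nhds_of_continuousAt
        ?_ ?_).differentiableAt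
      · filter_upwards [self_mem_nhdsWithin] with w hw using hgd' w hw
      · exact continuousAt_update_same.mpr riemannZeta_residue_one
    · exact hgd' z hz
  have hU : IsOpen {z : ℂ | 0 < z.re} := isOpen_lt continuous_const continuous_re
  have key : EqOn (fun z => (z - 1) * M z) (fun z => Gamma z * (1 - 2 ^ (1 - z)) * g z)
      {z : ℂ | 0 < z.re} := by
    refine AnalyticOnNhd.eqOn_of_preconnected_of_eventuallyEq (𝕜 := ℂ) (z₀ := 2) ?_ ?_
      (convex_halfSpace_re_gt 0).isPreconnected (by simp) ?_
    · refine DifferentiableOn.analyticOnNhd (fun z hz => ?_) hU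
      exact ((differentiableAt_id.sub_const 1).mul (salem_aux_diff hz)).differentiableWithinAt
    · refine DifferentiableOn.analyticOnNhd (fun z hz => ?_) hU
      refine DifferentiableAt.differentiableWithinAt ?_
      refine ((differentiableAt_Gamma z fun m hm => ?_).mul ?_).mul (hgd z)
      · rw [hm] at hz
        have : (0 : ℝ) < -(m : ℝ) := by simpa using hz
        linarith [(Nat.cast_nonneg m : (0 : ℝ) ≤ m)]
      · refine (differentiableAt_const _).sub ?_
        exact ((differentiableAt_const _).sub differentiableAt_id).const_cpow (Or.inl two_ne_zero)
    · have : {z : ℂ | 1 < z.re} ∈ 𝓝 (2 : ℂ) :=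
        (isOpen_lt continuous_const continuous_re).mem_nhds (by simp)
      filter_upwards [this] with z hz
      have hz1 : z ≠ 1 := by rintro rfl; simp at hz
      rw [hgne z hz1, hM, salem_aux_fermi hz]
      ring
  have := key hs
  simp only [hgne s hs1] at this
  refine mul_left_cancel₀ (sub_ne_zero.mpr hs1) (this.trans ?_)
  ring

lemma salem_aux_zero_iff {s : ℂ} (h0 : 0 < s.re) (h1 : s.re < 1) :
    mellin (fun t : ℝ => ((1 / (Real.exp t + 1) : ℝ) : ℂ)) s = 0 ↔ riemannZeta s = 0 := by
  have hs1 : s ≠ 1 := by rintro rfl; simp at h1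
  rw [salem_aux_main h0 hs1]
  have hp : (1 - 2 ^ (1 - s) : ℂ) ≠ 0 := by
    intro h
    have h2 : ‖(2 : ℂ) ^ (1 - s)‖ = 1 := by rw [← sub_eq_zero.mp h]; simp
    rw [← ofReal_ofNat, norm_cpow_eq_rpow_re_of_pos (by norm_num)] at h2
    have : (1 : ℝ) < 2 ^ (1 - s).re := Real.one_lt_rpow (by norm_num) (by simpa using h1)
    linarith
  simp [hp, Gamma_ne_zero_of_re_pos h0]

lemma salem_aux_integral (δ γ x : ℝ) (hx : 0 < x) :
    ∫ t in Ioi (0 : ℝ),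
      (t : ℂ) ^ ((δ : ℂ) - 1) * (t : ℂ) ^ (γ * I) / (Real.exp (x * t) + 1) =
    (x : ℂ) ^ (-(δ + γ * I)) *
      mellin (fun t : ℝ => ((1 / (Real.exp t + 1) : ℝ) : ℂ)) (δ + γ * I) := by
  have := mellin_comp_mul_left (fun t : ℝ => ((1 / (Real.exp t + 1) : ℝ) : ℂ)) (δ + γ * I) hx
  rw [smul_eq_mul] at this
  rw [← this]
  refine setIntegral_congr_fun measurableSet_Ioi fun t ht => ?_
  have ht : (t : ℂ) ≠ 0 := ofReal_ne_zero.mpr (ne_of_gt ht)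
  simp only [smul_eq_mul]
  rw [← cpow_add _ _ ht]
  push_cast
  rw [div_eq_mul_one_div]
  congr 2
  ring

lemma salem_aux_strip {s : ℂ} (hz : riemannZeta s = 0) (ht : ¬∃ n : ℕ, s = -2 * (n + 1)) :
    0 < s.re ∧ s.re < 1 := by
  have h1 : s.re < 1 := by
    by_contra h
    exact riemannZeta_ne_zero_of_one_le_re (not_lt.mp h) hz
  refine ⟨?_, h1⟩
  by_contra h0
  rw [not_lt] at h0
  have hs0 : s ≠ 0 := by
    rintro rfl
    rw [riemannZeta_zero] at hz
    norm_num at hz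
  have hw : 1 ≤ (1 - s).re := by simpa using h0
  have hfe := riemannZeta_one_sub (s := 1 - s) (fun n hn => ?_) (by simpa using hs0)
  · rw [sub_sub_cancel, hz] at hfe
    have hG : Gamma (1 - s) ≠ 0 := Gamma_ne_zero_of_re_pos (by linarith)
    have hZ := riemannZeta_ne_zero_of_one_le_re hw
    have hpi : (2 * Real.pi : ℂ) ^ (-(1 - s)) ≠ 0 := by
      rw [Ne, cpow_eq_zero_iff]
      simp [Real.pi_ne_zero]
    have hcos : cos (Real.pi * (1 - s) / 2) = 0 := by
      simpa [hG, hZ, hpi] using hfe.symm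
    obtain ⟨k, hk⟩ := cos_eq_zero_iff.mp hcos
    have hpi' : (Real.pi : ℂ) ≠ 0 := ofReal_ne_zero.mpr Real.pi_ne_zero
    have hsk : s = -2 * k := by
      have : (Real.pi : ℂ) * (1 - s) = Real.pi * (2 * k + 1) := by linear_combination 2 * hk
      have := mul_left_cancel₀ hpi' this
      linear_combination -this
    have hk0 : k ≠ 0 := by
      rintro rfl
      simp at hsk
      exact hs0 hsk
    have hkr : (0 : ℝ) ≤ k := by
      rw [hsk] at h0
      have : (-2 * (k : ℝ)) ≤ 0 := by simpa using h0
      linarith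
    have hk' : 0 ≤ k := by exact_mod_cast hkr
    obtain ⟨n, hn⟩ := Int.eq_ofNat_of_zero_le (show 0 ≤ k - 1 by omega)
    refine ht ⟨n, ?_⟩
    have : k = n + 1 := by omega
    rw [hsk, this]
    push_cast
    ring
  · rw [hn] at hw
    have : (1 : ℝ) ≤ -(n : ℝ) := by simpa using hw
    linarith [(Nat.cast_nonneg n : (0 : ℝ) ≤ n)]

theorem riemannHypothesis_iff_salem_no_power_solutions' :
    RiemannHypothesis ↔
      ∀ δ : ℝ, 0 < δ → δ < 1 → δ ≠ 1 / 2 → ∀ γ : ℝ,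
        ¬ (∀ x : ℝ, 0 < x →
            ∫ t in Ioi (0 : ℝ),
              (t : ℂ) ^ ((δ : ℂ) - 1) * (t : ℂ) ^ (γ * I) / (Real.exp (x * t) + 1) = 0) := by
  constructor
  · intro hRH δ h0 h1 hne γ hall
    have hre : ((δ : ℂ) + γ * I).re = δ := by simp
    have h := hall 1 one_pos
    rw [salem_aux_integral δ γ 1 one_pos, ofReal_one, one_cpow, one_mul,
      salem_aux_zero_iff (by rwa [hre]) (by rwa [hre])] at h
    apply hne
    rw [← hre]
    refine hRH _ h ?_ ?_
    · rintro ⟨n, hn⟩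
      have h2 := congrArg re hn
      rw [hre] at h2
      have h3 : δ = -2 * ((n : ℝ) + 1) := by simpa using h2
      linarith [(Nat.cast_nonneg n : (0 : ℝ) ≤ n)]
    · intro h2
      have h3 := congrArg re h2
      rw [hre, one_re] at h3
      linarith
  · intro hS s hz ht _
    obtain ⟨h0, h1⟩ := salem_aux_strip hz ht
    by_contra hne
    refine hS s.re h0 h1 hne s.im fun x hx => ?_
    rw [salem_aux_integral _ _ x hx, re_add_im, (salem_aux_zero_iff h0 h1).mpr hz, mul_zero]
end
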